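/- arXiv:1307.8383 — 2 statements merged into one kernel-verified Lean document; each statement's English description precedes it below -/
import Mathlib

section
/- Fix √ε ≠ 0 and a direction α with α − arg√ε ∈ (0, π), and let χ(s) := (1 − e^{sπi/√ε})^{−1}; χ is meromorphic with simple poles exactly at 2√ε·ℤ, and its residue at s = 0 equals −√ε/(πi). Let τ₁, τ₂ ∈ (0,1), c₁ := 2τ₁√ε, c₂ := −2τ₂√ε, and ξ ∈ ℂ. Let φ be holomorphic on an open strip of direction α containing the closed strip bounded by the lines ξ − c₁ − e^{iα}ℝ and ξ − c₂ − e^{iα}ℝ, with φ(z) → 0 as |z| → ∞ in this strip, and with ∫_ℝ |φ(ξ − c_j − e^{iα}u)| du < ∞ for j = 1,2. Then e^{iα} ∫_ℝ φ(ξ − c₂ − e^{iα}u)·χ(c₂ + e^{iα}u) du − e^{iα} ∫_ℝ φ(ξ − c₁ − e^{iα}u)·χ(c₁ + e^{iα}u) du = 2√ε·φ(ξ). Equivalently, the two expressions ∫_{c₁+e^{iα}ℝ} φ(ξ−s)χ(s) ds + √ε·φ(ξ) and ∫_{c₂+e^{iα}ℝ} φ(ξ−s)χ(s) ds − √ε·φ(ξ),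 which define the convolution of φ with the unfolded Borel transform of x, coincide. -/
open Complex MeasureTheory Real Filter Topology

/-- The unfolded kernel `χ(s) = (1 − e^{sπi/√ε})⁻¹`. -/
noncomputable def chiFun (sqe : ℂ) (s : ℂ) : ℂ :=
  (1 - Complex.exp (s * (Real.pi * Complex.I) / sqe))⁻¹

lemma aux_inv_int (y : ℝ) (hy : y ≠ 0) (R : ℝ) :
    ∫ x in (-R)..R, ((x : ℂ) + y * I)⁻¹ = -(2 * I) * (Real.arctan (R / y) : ℂ) := by
  have hne : ∀ x : ℝ, (x : ℂ) + y * I ≠ 0 := by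
    intro x h
    have := congrArg Complex.im h
    simp at this
    exact hy this
  have hcont : Continuous fun x : ℝ => ((x : ℂ) + y * I)⁻¹ :=
    Continuous.inv₀ (by fun_prop) hne
  have hder : ∀ x ∈ Set.uIcc (-R) R, HasDerivAt
      (fun x : ℝ => ((Real.log (x ^ 2 + y ^ 2) / 2 : ℝ) : ℂ) - I * (Real.arctan (x / y) : ℂ))
      (((x : ℂ) + y * I)⁻¹) x := by
    intro x _
    have hpos : 0 < x ^ 2 + y ^ 2 := by positivity
    have h1 : HasDerivAt (fun x : ℝ => Real.log (x ^ 2 + y ^ 2) / 2)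
        (x / (x ^ 2 + y ^ 2)) x := by
      have := (((hasDerivAt_id x).pow 2).add_const (y ^ 2)).log (by simpa using hpos.ne')
      refine (this.div_const 2).congr_deriv ?_
      simp only [id, Pi.pow_apply]
      field_simp
      norm_num
      ring
    have h2 : HasDerivAt (fun x : ℝ => Real.arctan (x / y)) (y / (x ^ 2 + y ^ 2)) x := by
      have := ((hasDerivAt_id x).div_const y).arctan
      refine this.congr_deriv ?_
      simp only [id]
      field_simp
      ring
    refine (h1.ofReal_comp.sub (h2.ofReal_comp.const_mul I)).congr_deriv ?_
    have hc : (x : ℂ) ^ 2 + (y : ℂ) ^ 2 ≠ 0 := by exact_mod_cast hpos.ne'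
    have := hne x
    push_cast
    apply eq_inv_of_mul_eq_one_left
    field_simp
    linear_combination (-(y : ℂ) ^ 2) * Complex.I_sq
  rw [intervalIntegral.integral_eq_sub_of_hasDerivAt hder (hcont.intervalIntegrable _ _)]
  simp [neg_div, Real.arctan_neg]
  ring

lemma aux_residue (F : ℂ → ℂ) (S : Set ℂ) (hS : IsOpen S) (y₁ y₂ : ℝ) (h1 : y₁ < 0) (h2 : 0 < y₂)
    (hsub : ∀ w : ℂ, y₁ ≤ w.im → w.im ≤ y₂ → w ∈ S) (hF : DifferentiableOn ℂ F S)
    (hdec : ∀ δ > 0, ∃ ρ : ℝ, ∀ w : ℂ, y₁ ≤ w.im → w.im ≤ y₂ → ρ ≤ |w.re| → ‖F w / w‖ ≤ δ)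
    (hi1 : Integrable fun u : ℝ => F (u + y₁ * I) / (u + y₁ * I))
    (hi2 : Integrable fun u : ℝ => F (u + y₂ * I) / (u + y₂ * I)) :
    (∫ u : ℝ, F (u + y₁ * I) / (u + y₁ * I)) - (∫ u : ℝ, F (u + y₂ * I) / (u + y₂ * I)) =
      2 * π * I * F 0 := by
  have h0 : (0 : ℂ) ∈ S := hsub 0 (by simpa using h1.le) (by simpa using h2.le)
  have hg : DifferentiableOn ℂ (dslope F 0) S :=
    (Complex.differentiableOn_dslope (hS.mem_nhds h0)).2 hF
  have hgv : ∀ w : ℂ, w ≠ 0 → dslope F 0 w = F w / w - F 0 * w⁻¹ := by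
    intro w hw
    rw [dslope_of_ne _ hw, slope_def_field]
    field_simp
    ring
  have hne : ∀ y : ℝ, y ≠ 0 → ∀ x : ℝ, (x : ℂ) + y * I ≠ 0 := by
    intro y hy x h
    have := congrArg Complex.im h
    simp at this
    exact hy this
  -- horizontal pieces
  have hor : ∀ y : ℝ, y ≠ 0 → (Integrable fun u : ℝ => F (u + y * I) / (u + y * I)) → ∀ R : ℝ,
      ∫ x in (-R)..R, dslope F 0 (x + y * I) =
      (∫ x in (-R)..R, F (x + y * I) / (x + y * I)) -
        F 0 * (-(2 * I) * (Real.arctan (R / y) : ℂ)) := by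
    intro y hy hi R
    have hcont : Continuous fun x : ℝ => ((x : ℂ) + y * I)⁻¹ :=
      Continuous.inv₀ (by fun_prop) (hne y hy)
    rw [← aux_inv_int y hy R, ← intervalIntegral.integral_const_mul,
      ← intervalIntegral.integral_sub hi.intervalIntegrable
        ((hcont.intervalIntegrable _ _).const_mul _)]
    refine intervalIntegral.integral_congr fun x _ => ?_
    exact hgv _ (hne y hy x)
  have lim1 : Tendsto (fun R : ℝ => ∫ x in (-R)..R, dslope F 0 (x + y₁ * I)) atTop
      (𝓝 ((∫ u : ℝ, F (u + y₁ * I) / (u + y₁ * I)) - F 0 * (-(2 * I) * ((-(π / 2) : ℝ) : ℂ)))) := by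
    simp_rw [hor y₁ h1.ne hi1]
    refine (intervalIntegral_tendsto_integral hi1 tendsto_neg_atTop_atBot tendsto_id).sub ?_
    refine (Tendsto.const_mul _ ?_).const_mul _
    refine (Complex.continuous_ofReal.tendsto _).comp ?_
    exact (tendsto_nhds_of_tendsto_nhdsWithin Real.tendsto_arctan_atBot).comp
      (tendsto_id.atTop_div_const_of_neg h1)
  have lim2 : Tendsto (fun R : ℝ => ∫ x in (-R)..R, dslope F 0 (x + y₂ * I)) atTop
      (𝓝 ((∫ u : ℝ, F (u + y₂ * I) / (u + y₂ * I)) - F 0 * (-(2 * I) * ((π / 2 : ℝ) : ℂ)))) := by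
    simp_rw [hor y₂ h2.ne' hi2]
    refine (intervalIntegral_tendsto_integral hi2 tendsto_neg_atTop_atBot tendsto_id).sub ?_
    refine (Tendsto.const_mul _ ?_).const_mul _
    refine (Complex.continuous_ofReal.tendsto _).comp ?_
    exact (tendsto_nhds_of_tendsto_nhdsWithin Real.tendsto_arctan_atTop).comp
      (tendsto_id.atTop_div_const h2)
  have hvd : ∀ δ > 0, ∃ ρ : ℝ, ∀ w : ℂ, y₁ ≤ w.im → w.im ≤ y₂ → ρ ≤ |w.re| →
      ‖dslope F 0 w‖ ≤ δ := by
    intro δ hδ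
    obtain ⟨ρ, hρ⟩ := hdec (δ / 2) (by positivity)
    refine ⟨max ρ (max 1 (‖F 0‖ / (δ / 2))), fun w hw1 hw2 hw3 => ?_⟩
    have hr1 : ρ ≤ |w.re| := (le_max_left _ _).trans hw3
    have hr2 : 1 ≤ |w.re| := (le_max_left _ _).trans ((le_max_right _ _).trans hw3)
    have hr3 : ‖F 0‖ / (δ / 2) ≤ |w.re| := (le_max_right _ _).trans ((le_max_right _ _).trans hw3)
    have hnw : |w.re| ≤ ‖w‖ := Complex.abs_re_le_norm w
    have hwpos : 0 < ‖w‖ := by linarith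
    rw [hgv w (norm_pos_iff.1 hwpos)]
    refine (norm_sub_le _ _).trans ?_
    have := hρ w hw1 hw2 hr1
    have h3 : ‖F 0 * w⁻¹‖ ≤ δ / 2 := by
      rw [norm_mul, norm_inv, ← div_eq_mul_inv, div_le_iff₀ hwpos]
      rw [div_le_iff₀ (by positivity)] at hr3
      nlinarith
    linarith
  have hver : ∀ σ : ℝ, |σ| = 1 →
      Tendsto (fun R : ℝ => ∫ y in y₁..y₂, dslope F 0 ((σ * R : ℝ) + y * I)) atTop (𝓝 0) := by
    intro σ hσ
    rw [Metric.tendsto_atTop]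
    intro δ hδ
    obtain ⟨ρ, hρ⟩ := hvd (δ / 2 / (y₂ - y₁)) (div_pos (by positivity) (by linarith))
    refine ⟨max ρ 0, fun R hR => ?_⟩
    rw [dist_zero_right]
    have := intervalIntegral.norm_integral_le_of_norm_le_const (a := y₁) (b := y₂)
      (f := fun y : ℝ => dslope F 0 ((σ * R : ℝ) + y * I)) (C := δ / 2 / (y₂ - y₁)) (by
        intro y hy
        rw [Set.uIoc_of_le (by linarith)] at hy
        refine hρ _ ?_ ?_ ?_
        · simpa using hy.1.le
        · simpa using hy.2
        · have : ρ ≤ |R| := (le_max_left _ _).trans (le_trans hR (le_abs_self R))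
          simpa [abs_mul, hσ] using this)
    refine this.trans_lt ?_
    rw [abs_of_pos (by linarith), div_mul_cancel₀ _ (by linarith)]
    linarith
  have hrect : ∀ R : ℝ, 
      (∫ x in (-R)..R, dslope F 0 (x + y₁ * I)) - (∫ x in (-R)..R, dslope F 0 (x + y₂ * I)) +
      I * (∫ y in y₁..y₂, dslope F 0 ((1 * R : ℝ) + y * I)) -
      I * (∫ y in y₁..y₂, dslope F 0 ((-1 * R : ℝ) + y * I)) = 0 := by
    intro R
    have := Complex.integral_boundary_rect_eq_zero_of_differentiableOn (dslope F 0)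
      (⟨-R, y₁⟩ : ℂ) ⟨R, y₂⟩ (hg.mono (by
        intro w hw
        rw [Complex.mem_reProdIm] at hw
        have := hw.2
        simp only at this
        rw [Set.uIcc_of_le (by linarith)] at this
        exact hsub w this.1 this.2))
    simpa using this
  have hlim := ((lim1.sub lim2).add ((hver 1 (by simp)).const_mul I)).sub
    ((hver (-1) (by simp)).const_mul I)
  simp_rw [hrect] at hlim
  have := tendsto_nhds_unique hlim tendsto_const_nhds
  push_cast at this
  linear_combination this

lemma aux_norm_chi {z : ℂ} (hz : 1 ≤ |z.re|) : ‖(1 - Complex.exp z)⁻¹‖ ≤ 2 := by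
  have h : 1 / 2 ≤ ‖1 - Complex.exp z‖ := by
    rcases le_abs.1 hz with h | h
    · have h1 : (2 : ℝ) ≤ Real.exp z.re := by
        have := Real.add_one_le_exp z.re
        linarith
      have := norm_sub_norm_le (Complex.exp z) 1
      rw [norm_sub_rev, Complex.norm_exp, norm_one] at this
      linarith
    · have h1 : (2 : ℝ) ≤ Real.exp (-z.re) := by
        have := Real.add_one_le_exp (-z.re)
        linarith
      have h2 : Real.exp z.re ≤ 1 / 2 := by
        rw [Real.exp_neg] at h1
        have := Real.exp_pos z.re
        rw [le_inv_comm₀ (by norm_num) this] at h1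
        linarith
      have := norm_sub_norm_le 1 (Complex.exp z)
      rw [Complex.norm_exp, norm_one] at this
      linarith
  rw [norm_inv]
  calc ‖1 - Complex.exp z‖⁻¹ ≤ (1 / 2 : ℝ)⁻¹ := inv_anti₀ (by norm_num) h
    _ = 2 := by norm_num

/-- far away in a horizontal strip the kernel is bounded -/
lemma aux_far (k : ℂ) (hk : k.re ≠ 0) (Y : ℝ) : ∃ M : ℝ, ∀ w : ℂ, |w.im| ≤ Y → M ≤ |w.re| →
    ‖(1 - Complex.exp (k * w))⁻¹‖ ≤ 2 := by
  have hk' : 0 < |k.re| := abs_pos.2 hk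
  refine ⟨(1 + |k.im| * Y) / |k.re|, fun w h1 h2 => aux_norm_chi ?_⟩
  rw [div_le_iff₀ hk'] at h2
  rw [Complex.mul_re]
  have h3 := abs_sub_abs_le_abs_sub (k.re * w.re) (k.im * w.im)
  rw [abs_mul, abs_mul] at h3
  have h4 : |k.im| * |w.im| ≤ |k.im| * Y := by gcongr
  nlinarith

lemma aux_line_int (k : ℂ) (hk : k.re ≠ 0) (c : ℂ)
    (hne : ∀ u : ℝ, Complex.exp (k * (c + u)) ≠ 1)
    (f : ℝ → ℂ) (hf : Integrable f) :
    Integrable fun u : ℝ => f u * (1 - Complex.exp (k * (c + u)))⁻¹ := by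
  have hcont : Continuous fun u : ℝ => (1 - Complex.exp (k * (c + u)))⁻¹ :=
    Continuous.inv₀ (by fun_prop) (fun u => sub_ne_zero.2 (hne u).symm)
  obtain ⟨M, hM⟩ := aux_far k hk |c.im|
  obtain ⟨C, hC⟩ := (isCompact_Icc (a := -(M + |c.re|)) (b := M + |c.re|)).exists_bound_of_continuousOn
    hcont.continuousOn
  refine hf.mul_bdd (c := max 2 C) hcont.aestronglyMeasurable (Eventually.of_forall fun u => ?_)
  by_cases hu : |u| ≤ M + |c.re|
  · exact (hC u (abs_le.1 hu)).trans (le_max_right _ _)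
  · refine (hM (c + u) (by simp) ?_).trans (le_max_left _ _)
    push Not at hu
    have : |u| ≤ |c.re + u| + |c.re| := by
      have := abs_sub (c.re + u) c.re
      simpa using this
    simp
    linarith

lemma aux_main (q : ℂ) (hq : q.im < 0) (ψ : ℂ → ℂ) (a b τ₁ τ₂ : ℝ)
    (hτ₁ : τ₁ ∈ Set.Ioo (0 : ℝ) 1) (hτ₂ : τ₂ ∈ Set.Ioo (0 : ℝ) 1)
    (h1 : 2 * τ₁ * q.im ∈ Set.Ioo a b) (h2 : -(2 * τ₂ * q.im) ∈ Set.Ioo a b)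
    (hψ : DifferentiableOn ℂ ψ {w | w.im ∈ Set.Ioo a b})
    (hdec : ∀ δ > 0, ∃ ρ : ℝ, ∀ w : ℂ, w.im ∈ Set.Ioo a b → ρ ≤ ‖w‖ → ‖ψ w‖ ≤ δ)
    (hi1 : Integrable fun u : ℝ => ψ (2 * τ₁ * q + u))
    (hi2 : Integrable fun u : ℝ => ψ (-(2 * τ₂ * q) + u)) :
    (Integrable fun u : ℝ => ψ (-(2 * τ₂ * q) + u) *
      (1 - Complex.exp (π * I / q * (-(2 * τ₂ * q) + u)))⁻¹) ∧
    (Integrable fun u : ℝ => ψ (2 * τ₁ * q + u) *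
      (1 - Complex.exp (π * I / q * (2 * τ₁ * q + u)))⁻¹) ∧
    (∫ u : ℝ, ψ (-(2 * τ₂ * q) + u) * (1 - Complex.exp (π * I / q * (-(2 * τ₂ * q) + u)))⁻¹) -
    (∫ u : ℝ, ψ (2 * τ₁ * q + u) * (1 - Complex.exp (π * I / q * (2 * τ₁ * q + u)))⁻¹) =
      2 * q * ψ 0 := by
  have hq0 : q ≠ 0 := by
    rintro rfl
    simp at hq
  have hpi : (π : ℂ) ≠ 0 := by exact_mod_cast Real.pi_ne_zero
  set k : ℂ := π * I / q with hkdef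
  have hk0 : k ≠ 0 := by
    rw [hkdef]
    exact div_ne_zero (mul_ne_zero hpi I_ne_zero) hq0
  have hk : k.re ≠ 0 := by
    have : k.re = π * q.im / Complex.normSq q := by
      rw [hkdef, Complex.div_re]
      simp
    rw [this]
    exact div_ne_zero (mul_ne_zero Real.pi_ne_zero hq.ne) (Complex.normSq_pos.2 hq0).ne'
  obtain ⟨ht1, ht1b⟩ := hτ₁
  obtain ⟨ht2, ht2b⟩ := hτ₂
  set y₁ : ℝ := 2 * τ₁ * q.im with hy1
  set y₂ : ℝ := -(2 * τ₂ * q.im) with hy2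
  have hy1neg : y₁ < 0 := by rw [hy1]; nlinarith
  have hy2pos : 0 < y₂ := by rw [hy2]; nlinarith
  -- zeros of `exp (k w) - 1` in the closed strip
  have hzero : ∀ w : ℂ, y₁ ≤ w.im → w.im ≤ y₂ → Complex.exp (k * w) = 1 → w = 0 := by
    intro w hw1 hw2 he
    obtain ⟨n, hn⟩ := Complex.exp_eq_one_iff.1 he
    have hw : w = ((2 * n : ℝ) : ℂ) * q := by
      have h3 : (π * I : ℂ) ≠ 0 := mul_ne_zero hpi I_ne_zero
      rw [hkdef, div_mul_eq_mul_div, div_eq_iff hq0] at hn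
      apply mul_left_cancel₀ h3
      rw [hn]
      push_cast
      ring
    have him : w.im = 2 * n * q.im := by
      rw [hw, Complex.im_ofReal_mul]
    rw [him, hy1] at hw1
    rw [him, hy2] at hw2
    have hn1 : (n : ℝ) < 1 := by nlinarith
    have hn2 : (-1 : ℝ) < n := by nlinarith
    have hn0 : n = 0 := by
      have : n < 1 := by exact_mod_cast hn1
      have : -1 < n := by exact_mod_cast hn2
      omega
    rw [hw, hn0]
    simp
  have im1 : ∀ u : ℝ, (2 * τ₁ * q + u : ℂ).im = y₁ := by
    intro u
    have : (2 * τ₁ * q + u : ℂ) = ((2 * τ₁ : ℝ) : ℂ) * q + (u : ℂ) := by push_cast; ring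
    rw [this, Complex.add_im, Complex.im_ofReal_mul, Complex.ofReal_im, add_zero]
  have im2 : ∀ u : ℝ, (-(2 * τ₂ * q) + u : ℂ).im = y₂ := by
    intro u
    have : (-(2 * τ₂ * q) + u : ℂ) = ((-(2 * τ₂) : ℝ) : ℂ) * q + (u : ℂ) := by push_cast; ring
    rw [this, Complex.add_im, Complex.im_ofReal_mul, Complex.ofReal_im, add_zero, hy2]
    ring
  have ne_of_im : ∀ w : ℂ, ∀ y : ℝ, w.im = y → y ≠ 0 → w ≠ 0 := by
    rintro w y hw hy rfl
    exact hy (by simpa using hw.symm)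
  have J1 := aux_line_int k hk (2 * τ₁ * q) (fun u he =>
    ne_of_im _ _ (im1 u) hy1neg.ne (hzero _ (im1 u).ge (by rw [im1 u]; linarith) he)) _ hi1
  have J2 := aux_line_int k hk (-(2 * τ₂ * q)) (fun u he =>
    ne_of_im _ _ (im2 u) hy2pos.ne' (hzero _ (by rw [im2 u]; linarith) (im2 u).le he)) _ hi2
  refine ⟨J2, J1, ?_⟩
  -- the entire function `(exp (k w) - 1) / w`
  set D : ℂ → ℂ := dslope (fun w => Complex.exp (k * w)) 0 with hD
  have hDdiff : Differentiable ℂ D := by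
    rw [← differentiableOn_univ]
    refine (Complex.differentiableOn_dslope Filter.univ_mem).2 ?_
    rw [differentiableOn_univ]
    fun_prop
  have hD0 : D 0 = k := by
    rw [hD, dslope_same]
    have : HasDerivAt (fun w : ℂ => Complex.exp (k * w)) (Complex.exp (k * 0) * (k * 1)) 0 :=
      ((hasDerivAt_id (0 : ℂ)).const_mul k).cexp
    rw [this.deriv]
    simp
  have hDne : ∀ w : ℂ, w ≠ 0 → D w = (Complex.exp (k * w) - 1) / w := by
    intro w hw
    rw [hD, dslope_of_ne _ hw, slope_def_field]
    simp
  have hDnz : ∀ w : ℂ, y₁ ≤ w.im → w.im ≤ y₂ → D w ≠ 0 := by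
    intro w hw1 hw2
    by_cases hw : w = 0
    · rw [hw, hD0]
      exact hk0
    · rw [hDne w hw]
      exact div_ne_zero (sub_ne_zero.2 fun h => hw (hzero w hw1 hw2 h)) hw
  have hG : ∀ w : ℂ, w ≠ 0 → -ψ w / D w / w = ψ w * (1 - Complex.exp (k * w))⁻¹ := by
    intro w hw
    rw [hDne w hw, div_div, div_mul_cancel₀ _ hw, ← div_eq_mul_inv, ← neg_sub, neg_div_neg_eq]
  set G : ℂ → ℂ := fun w => ψ w * (1 - Complex.exp (k * w))⁻¹ with hGdef
  have shift1 : ∀ u : ℝ, G (u + y₁ * I) = G (2 * τ₁ * q + ((u - 2 * τ₁ * q.re : ℝ) : ℂ)) := by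
    intro u
    congr 1
    apply Complex.ext <;> simp [hy1]
  have shift2 : ∀ u : ℝ, G (u + y₂ * I) = G (-(2 * τ₂ * q) + ((u - (-(2 * τ₂ * q.re)) : ℝ) : ℂ)) := by
    intro u
    congr 1
    apply Complex.ext <;> simp [hy2]
  have hline : ∀ y : ℝ, y ≠ 0 → ∀ u : ℝ,
      -ψ (u + y * I) / D (u + y * I) / (u + y * I) = G (u + y * I) := by
    intro y hy u
    exact hG _ (ne_of_im _ y (by simp) hy)
  have key := aux_residue (fun w => -ψ w / D w) ({w | w.im ∈ Set.Ioo a b} ∩ {w | D w ≠ 0})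
    ((isOpen_Ioo.preimage Complex.continuous_im).inter
      (isOpen_ne.preimage hDdiff.continuous)) y₁ y₂ hy1neg hy2pos
    (fun w hw1 hw2 => ⟨⟨h1.1.trans_le hw1, hw2.trans_lt h2.2⟩, hDnz w hw1 hw2⟩)
    (((hψ.mono Set.inter_subset_left).neg).div hDdiff.differentiableOn (fun w hw => hw.2))
    (by
      intro δ hδ
      obtain ⟨ρ, hρ⟩ := hdec (δ / 2) (by positivity)
      obtain ⟨M, hM⟩ := aux_far k hk (max |y₁| |y₂|)
      refine ⟨max 1 (max ρ M), fun w hw1 hw2 hw3 => ?_⟩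
      have e1 : 1 ≤ |w.re| := (le_max_left _ _).trans hw3
      have e2 : ρ ≤ |w.re| := (le_max_left _ _).trans ((le_max_right _ _).trans hw3)
      have e3 : M ≤ |w.re| := (le_max_right _ _).trans ((le_max_right _ _).trans hw3)
      have hnw : |w.re| ≤ ‖w‖ := Complex.abs_re_le_norm w
      have hw : w ≠ 0 := norm_pos_iff.1 (by linarith)
      rw [hG w hw, norm_mul]
      have a1 := hρ w ⟨h1.1.trans_le hw1, hw2.trans_lt h2.2⟩ (e2.trans hnw)
      have a2 := hM w (abs_le_max_abs_abs hw1 hw2) e3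
      calc _ ≤ δ / 2 * 2 := by gcongr
        _ = δ := by ring)
    (by
      simp_rw [hline y₁ hy1neg.ne, shift1]
      exact J1.comp_sub_right (2 * τ₁ * q.re))
    (by
      simp_rw [hline y₂ hy2pos.ne', shift2]
      exact J2.comp_sub_right (-(2 * τ₂ * q.re)))
  simp only [hline y₁ hy1neg.ne, hline y₂ hy2pos.ne', shift1, shift2] at key
  rw [integral_sub_right_eq_self (fun u : ℝ => G (2 * τ₁ * q + u)),
    integral_sub_right_eq_self (fun u : ℝ => G (-(2 * τ₂ * q) + u)), hD0] at key
  have hval : 2 * π * I * (-ψ 0 / k) = -(2 * q * ψ 0) := by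
    rw [hkdef]
    field_simp
  rw [hval] at key
  change (∫ u : ℝ, G (-(2 * τ₂ * q) + u)) - (∫ u : ℝ, G (2 * τ₁ * q + u)) = _
  linear_combination -key

/-- Definition 3.7 of the paper, well-definedness of the convolution
with the unfolded Borel transform of `x`. The kernel `χ` has simple poles exactly at
`2√ε·ℤ`, with residue `−√ε/(πi)` at `0`, and the two contour integrals of `φ(ξ−s)χ(s)`
along the lines `c₁ + e^{iα}ℝ` and `c₂ + e^{iα}ℝ` (on either side of the pole `s = 0`)
differ by the residue term `2√ε·φ(ξ)`. -/
theorem chi_contour_difference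
    (sqe : ℂ) (hsqe : sqe ≠ 0)
    (α : ℝ) (hα : α - Complex.arg sqe ∈ Set.Ioo 0 Real.pi)
    (τ₁ τ₂ : ℝ) (hτ₁ : τ₁ ∈ Set.Ioo (0 : ℝ) 1) (hτ₂ : τ₂ ∈ Set.Ioo (0 : ℝ) 1)
    (ξ : ℂ) (φ : ℂ → ℂ) (b₁ b₂ : ℝ) (hb : b₁ < b₂)
    (hmem₁ : (Complex.exp (-α * Complex.I) *
      (ξ - (2 * τ₁ : ℝ) * sqe)).im ∈ Set.Ioo b₁ b₂)
    (hmem₂ : (Complex.exp (-α * Complex.I) *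
      (ξ - (-((2 * τ₂ : ℝ) * sqe)))).im ∈ Set.Ioo b₁ b₂)
    (hφ : DifferentiableOn ℂ φ
      {z : ℂ | (Complex.exp (-α * Complex.I) * z).im ∈ Set.Ioo b₁ b₂})
    (hdecay : ∀ δ > 0, ∃ ρ : ℝ, ∀ z : ℂ,
      (Complex.exp (-α * Complex.I) * z).im ∈ Set.Ioo b₁ b₂ → ρ ≤ ‖z‖ → ‖φ z‖ ≤ δ)
    (hint₁ : Integrable fun u : ℝ =>
      φ (ξ - (2 * τ₁ : ℝ) * sqe - Complex.exp (α * Complex.I) * u))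
    (hint₂ : Integrable fun u : ℝ =>
      φ (ξ - (-((2 * τ₂ : ℝ) * sqe)) - Complex.exp (α * Complex.I) * u)) :
    -- χ is holomorphic away from 2√ε·ℤ ...
    (∀ s : ℂ, (∀ m : ℤ, s ≠ 2 * sqe * m) → DifferentiableAt ℂ (chiFun sqe) s) ∧
    -- ... with simple poles at the points of 2√ε·ℤ, of residue −√ε/(πi)
    (∀ m : ℤ, Tendsto (fun s : ℂ => (s - 2 * sqe * m) * chiFun sqe s)
      (𝓝[≠] (2 * sqe * m)) (𝓝 (-sqe / (Real.pi * Complex.I)))) ∧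
    -- both convolution integrals converge absolutely ...
    (Integrable fun u : ℝ =>
      φ (ξ - (-((2 * τ₂ : ℝ) * sqe)) - Complex.exp (α * Complex.I) * u) *
        chiFun sqe (-((2 * τ₂ : ℝ) * sqe) + Complex.exp (α * Complex.I) * u)) ∧
    (Integrable fun u : ℝ =>
      φ (ξ - (2 * τ₁ : ℝ) * sqe - Complex.exp (α * Complex.I) * u) *
        chiFun sqe ((2 * τ₁ : ℝ) * sqe + Complex.exp (α * Complex.I) * u)) ∧
    -- ... and differ exactly by the residue term 2√ε·φ(ξ)
    Complex.exp (α * Complex.I) *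
        (∫ u : ℝ, φ (ξ - (-((2 * τ₂ : ℝ) * sqe)) - Complex.exp (α * Complex.I) * u) *
          chiFun sqe (-((2 * τ₂ : ℝ) * sqe) + Complex.exp (α * Complex.I) * u)) -
      Complex.exp (α * Complex.I) *
        (∫ u : ℝ, φ (ξ - (2 * τ₁ : ℝ) * sqe - Complex.exp (α * Complex.I) * u) *
          chiFun sqe ((2 * τ₁ : ℝ) * sqe + Complex.exp (α * Complex.I) * u)) =
      2 * sqe * φ ξ := by
  have hpi : (π : ℂ) ≠ 0 := by exact_mod_cast Real.pi_ne_zero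
  have hpiI : (π * I : ℂ) ≠ 0 := mul_ne_zero hpi I_ne_zero
  set e : ℂ := Complex.exp (α * I) with he
  set ei : ℂ := Complex.exp (-α * I) with hei
  have hee : ei * e = 1 := by
    rw [he, hei, ← Complex.exp_add]
    simp
  have hne : ∀ s : ℂ, (∀ m : ℤ, s ≠ 2 * sqe * m) →
      1 - Complex.exp (s * (π * I) / sqe) ≠ 0 := by
    intro s hs h
    obtain ⟨n, hn⟩ := Complex.exp_eq_one_iff.1 (sub_eq_zero.1 h).symm
    apply hs n
    rw [div_eq_iff hsqe] at hn
    apply mul_right_cancel₀ hpiI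
    rw [hn]
    ring
  refine ⟨?_, ?_, ?_⟩
  · intro s hs
    unfold chiFun
    exact DifferentiableAt.inv (by fun_prop) (hne s hs)
  · intro m
    have hz : Complex.exp (2 * sqe * m * (π * I) / sqe) = 1 := by
      rw [Complex.exp_eq_one_iff]
      refine ⟨m, ?_⟩
      field_simp
    have hd : HasDerivAt (fun s : ℂ => 1 - Complex.exp (s * (π * I) / sqe))
        (-(π * I / sqe)) (2 * sqe * m) := by
      have := ((((hasDerivAt_id (2 * sqe * m : ℂ)).mul_const (π * I : ℂ)).div_const sqe).cexp).const_sub 1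
      refine this.congr_deriv ?_
      simp only [id]
      rw [hz]
      ring
    have ht := (hasDerivAt_iff_tendsto_slope.1 hd).inv₀
      (neg_ne_zero.2 (div_ne_zero hpiI hsqe))
    have hv : (-(π * I / sqe) : ℂ)⁻¹ = -sqe / (π * I) := by
      rw [inv_neg, inv_div, neg_div]
    rw [hv] at ht
    refine ht.congr fun s => ?_
    rw [slope_def_field, hz, sub_self, sub_zero, inv_div, div_eq_mul_inv]
    rfl
  · set q : ℂ := ei * sqe with hqdef
    have hsq : sqe = e * q := by
      rw [hqdef, ← mul_assoc, mul_comm e, hee, one_mul]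
    have hq : q.im < 0 := by
      have h1 : q = ((‖sqe‖ : ℝ) : ℂ) * Complex.exp (((Complex.arg sqe - α : ℝ) : ℂ) * I) := by
        have h2 : ((Complex.arg sqe - α : ℝ) : ℂ) * I = -α * I + Complex.arg sqe * I := by
          push_cast
          ring
        rw [h2, Complex.exp_add, hqdef]
        conv_lhs => rw [← Complex.norm_mul_exp_arg_mul_I sqe]
        ring
      rw [h1, Complex.im_ofReal_mul, Complex.exp_ofReal_mul_I_im, ← neg_sub α, Real.sin_neg]
      have := Real.sin_pos_of_mem_Ioo hα
      have := norm_pos_iff.2 hsqe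
      nlinarith
    have hq0 : q ≠ 0 := by
      intro h
      rw [h] at hq
      simp at hq
    have he0 : e ≠ 0 := Complex.exp_ne_zero _
    have hchi : ∀ w : ℂ, chiFun sqe (e * w) = (1 - Complex.exp (π * I / q * w))⁻¹ := by
      intro w
      unfold chiFun
      congr 3
      rw [hsq]
      field_simp
    set β : ℝ := (ei * ξ).im with hβ
    have him : ∀ w : ℂ, (ei * (ξ - e * w)).im = β - w.im := by
      intro w
      have : ei * (ξ - e * w) = ei * ξ - w := by linear_combination (-w) * hee
      rw [this, Complex.sub_im]
    have harg1 : ∀ u : ℝ, ξ - (2 * τ₁ : ℝ) * sqe - e * u = ξ - e * (2 * τ₁ * q + u) := by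
      intro u
      rw [hsq]
      push_cast
      ring
    have harg2 : ∀ u : ℝ, ξ - (-((2 * τ₂ : ℝ) * sqe)) - e * u =
        ξ - e * (-(2 * τ₂ * q) + u) := by
      intro u
      rw [hsq]
      push_cast
      ring
    have hpt1 : ∀ u : ℝ, ((2 * τ₁ : ℝ) : ℂ) * sqe + e * u = e * (2 * τ₁ * q + u) := by
      intro u
      rw [hsq]
      push_cast
      ring
    have hpt2 : ∀ u : ℝ, -(((2 * τ₂ : ℝ) : ℂ) * sqe) + e * u = e * (-(2 * τ₂ * q) + u) := by
      intro u
      rw [hsq]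
      push_cast
      ring
    simp only [harg1] at hint₁
    simp only [harg2] at hint₂
    have hm1 : 2 * τ₁ * q.im ∈ Set.Ioo (β - b₂) (β - b₁) := by
      have h1 : ξ - (2 * τ₁ : ℝ) * sqe = ξ - e * (((2 * τ₁ : ℝ) : ℂ) * q) := by
        rw [hsq]
        ring
      rw [h1, him, Complex.im_ofReal_mul] at hmem₁
      exact ⟨by linarith [hmem₁.2], by linarith [hmem₁.1]⟩
    have hm2 : -(2 * τ₂ * q.im) ∈ Set.Ioo (β - b₂) (β - b₁) := by
      have h1 : ξ - (-((2 * τ₂ : ℝ) * sqe)) = ξ - e * (((-(2 * τ₂) : ℝ) : ℂ) * q) := by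
        rw [hsq]
        push_cast
        ring
      rw [h1, him, Complex.im_ofReal_mul] at hmem₂
      exact ⟨by linarith [hmem₂.2], by linarith [hmem₂.1]⟩
    have hstrip : ∀ w : ℂ, w.im ∈ Set.Ioo (β - b₂) (β - b₁) →
        (ei * (ξ - e * w)).im ∈ Set.Ioo b₁ b₂ := by
      intro w hw
      rw [him]
      exact ⟨by linarith [hw.2], by linarith [hw.1]⟩
    have hnorme : ‖e‖ = 1 := by rw [he, Complex.norm_exp_ofReal_mul_I]
    obtain ⟨K2, K1, K⟩ := aux_main q hq (fun w => φ (ξ - e * w)) (β - b₂) (β - b₁) τ₁ τ₂ hτ₁ hτ₂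
      hm1 hm2
      (hφ.comp (Differentiable.differentiableOn (by fun_prop)) (fun w hw => hstrip w hw))
      (by
        intro δ hδ
        obtain ⟨ρ, hρ⟩ := hdecay δ hδ
        refine ⟨ρ + ‖ξ‖, fun w hw1 hw2 => hρ _ (hstrip w hw1) ?_⟩
        have h3 := norm_sub_norm_le (e * w) ξ
        rw [norm_sub_rev, norm_mul, hnorme, one_mul] at h3
        linarith)
      hint₁ hint₂
    simp only [harg1, harg2, hpt1, hpt2, hchi]
    refine ⟨K2, K1, ?_⟩
    simp only [mul_zero, sub_zero] at K
    rw [← mul_sub, K, hsq]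
    ring
end

section
/- With the notation of the context, let arg√ε < α₁ < α₂ < arg√ε + π, let Λ ≥ 0 be such that 2Λ < −Re(e^{iα}πi/√ε) for all α ∈ [α₁, α₂], and let a, b ∈ ℝ with a + b > 0. Let g be holomorphic on D := ⋃_{α∈[α₁,α₂]} S_α(Λ) with |g(t)| ≤ K·|e^{−2√ε t}|^a · |1 − e^{−2√ε t}|^{−(a+b)} for all t ∈ D and some K > 0. Then for every ξ ∈ Ω_{α₁}(a,b) ∩ Ω_{α₂}(a,b) one has B_{α₁}⁺[g](ξ) = B_{α₂}⁺[g](ξ); i.e. the unfolded Borel transforms taken in different admissible directions are analytic continuations of one another. -/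
open Complex MeasureTheory Real

/-- The width `−Re(e^{iα}πi/√ε)` of the unfolded strips in the time coordinate. -/
noncomputable def stripWidth (α : ℝ) (sqe : ℂ) : ℝ :=
  -(Complex.exp (α * Complex.I) * (Real.pi * Complex.I) / sqe).re

/-- The strip `S_α(Λ)` in the time coordinate. -/
noncomputable def timeStrip (α : ℝ) (sqe : ℂ) (Λ : ℝ) : Set ℂ :=
  {t : ℂ | Λ < (Complex.exp (α * Complex.I) * t).re ∧
    (Complex.exp (α * Complex.I) * t).re < stripWidth α sqe - Λ}

/-- The point `e^{−iα}(C + iu)` of the line `Re(e^{iα}t) = C`. -/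
noncomputable def timePt (α : ℝ) (C : ℝ) (u : ℝ) : ℂ :=
  Complex.exp (-α * Complex.I) * (C + Complex.I * u)

/-- The unfolded Borel transform `B_α⁺[g](ξ)` along the line `Re(e^{iα}t) = C`. -/
noncomputable def unfoldedBorel (α : ℝ) (g : ℂ → ℂ) (C : ℝ) (ξ : ℂ) : ℂ :=
  (1 / (2 * Real.pi * Complex.I)) * (Complex.I * Complex.exp (-α * Complex.I)) *
    ∫ u : ℝ, g (timePt α C u) * Complex.exp (timePt α C u * ξ)

/-- The strip `Ω_α(a,b)` of direction `α` between `2a√ε` and `−2b√ε` in the Borel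
plane. -/
noncomputable def borelStrip (α : ℝ) (sqe : ℂ) (a b : ℝ) : Set ℂ :=
  {ξ : ℂ | (Complex.exp (-α * Complex.I) * ((2 * a : ℝ) * sqe)).im <
      (Complex.exp (-α * Complex.I) * ξ).im ∧
    (Complex.exp (-α * Complex.I) * ξ).im <
      -(Complex.exp (-α * Complex.I) * ((2 * b : ℝ) * sqe)).im}

open Filter Topology in
/-- Ends of the contours: a primitive has asymptotically equal values along two rays. -/
lemma aux_end (D : Set ℂ) (h H : ℂ → ℂ) (hH : ∀ z ∈ D, HasDerivAt H (h z) z)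
    (c d : ℂ) (K : ℝ) (hK : 0 ≤ K)
    (hb : ∀ t ∈ D, 1 ≤ (t * d).re → ‖h t‖ ≤ K * Real.exp ((t * c).re))
    (p v q w : ℂ) (hvc : (v * c).re < 0) (hwc : (w * c).re < 0)
    (hvd : 0 < (v * d).re) (hwd : 0 < (w * d).re)
    (hseg : ∀ R : ℝ, 0 ≤ R → segment ℝ (p + R * v) (q + R * w) ⊆ D) :
    Tendsto (fun R : ℝ => H (q + R * w) - H (p + R * v)) atTop (𝓝 0) := by
  obtain ⟨δ, hδ, hδv, hδw⟩ : ∃ δ : ℝ, 0 < δ ∧ (v * c).re ≤ -δ ∧ (w * c).re ≤ -δ :=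
    ⟨min (-(v * c).re) (-(w * c).re), lt_min (by linarith) (by linarith),
      by linarith [min_le_left (-(v * c).re) (-(w * c).re)],
      by linarith [min_le_right (-(v * c).re) (-(w * c).re)]⟩
  set M := max (p * c).re (q * c).re with hM
  have hpM : (p * c).re ≤ M := le_max_left _ _
  have hqM : (q * c).re ≤ M := le_max_right _ _
  have key : ∀ᶠ R : ℝ in atTop, ‖H (q + R * w) - H (p + R * v)‖ ≤
      (K * Real.exp (M - δ * R)) * (‖q - p‖ + R * ‖w - v‖) := by
    have e1 : ∀ᶠ R : ℝ in atTop, 1 ≤ (p * d).re + R * (v * d).re :=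
      (tendsto_atTop_add_const_left _ _ (tendsto_id.atTop_mul_const hvd)).eventually_ge_atTop 1
    have e2 : ∀ᶠ R : ℝ in atTop, 1 ≤ (q * d).re + R * (w * d).re :=
      (tendsto_atTop_add_const_left _ _ (tendsto_id.atTop_mul_const hwd)).eventually_ge_atTop 1
    filter_upwards [e1, e2, eventually_ge_atTop 0] with R h1 h2 hR
    have hs := hseg R hR
    have hbd : ∀ x ∈ segment ℝ (p + R * v) (q + R * w),
        ‖h x‖ ≤ K * Real.exp (M - δ * R) := by
      intro x hx
      have hxD := hs hx
      obtain ⟨s, r, hs0, hr0, hsr, rfl⟩ := hx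
      have lin : ∀ z : ℂ, ((s • (p + R * v) + r • (q + R * w)) * z).re =
          s * ((p * z).re + R * (v * z).re) + r * ((q * z).re + R * (w * z).re) := by
        intro z
        simp
        ring
      refine (hb _ hxD ?_).trans ?_
      · rw [lin]
        have := mul_le_mul_of_nonneg_left h1 hs0
        have := mul_le_mul_of_nonneg_left h2 hr0
        linarith
      · gcongr
        rw [lin]
        have a1 : (p * c).re + R * (v * c).re ≤ M - δ * R := by nlinarith
        have a2 : (q * c).re + R * (w * c).re ≤ M - δ * R := by nlinarith
        have b1 := mul_le_mul_of_nonneg_left a1 hs0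
        have b2 := mul_le_mul_of_nonneg_left a2 hr0
        have : s * (M - δ * R) + r * (M - δ * R) = M - δ * R := by
          rw [← add_mul, hsr, one_mul]
        linarith
    have := (convex_segment (𝕜 := ℝ) (p + R * v) (q + R * w)).norm_image_sub_le_of_norm_hasDerivWithin_le
      (fun x hx => (hH x (hs hx)).hasDerivWithinAt) hbd
      (left_mem_segment ℝ _ _) (right_mem_segment ℝ _ _)
    refine this.trans ?_
    gcongr
    have : (q + R * w) - (p + R * v) = (q - p) + R * (w - v) := by ring
    rw [this]
    refine (norm_add_le _ _).trans ?_
    rw [norm_mul, Complex.norm_real, Real.norm_of_nonneg hR]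
  refine squeeze_zero_norm' key ?_
  have t0 : Tendsto (fun R : ℝ => Real.exp (-δ * R)) atTop (𝓝 0) := by
    refine Real.tendsto_exp_atBot.comp ?_
    exact tendsto_id.const_mul_atTop_of_neg (by linarith)
  have t1 : Tendsto (fun R : ℝ => R * Real.exp (-δ * R)) atTop (𝓝 0) := by
    have := Real.tendsto_pow_mul_exp_neg_atTop_nhds_zero 1
    have := (this.comp (tendsto_id.const_mul_atTop hδ)).const_mul (δ⁻¹)
    simp only [mul_zero] at this
    refine this.congr fun R => ?_
    simp
    field_simp
  have : Tendsto (fun R : ℝ => K * Real.exp M * ‖q - p‖ * Real.exp (-δ * R) +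
      K * Real.exp M * ‖w - v‖ * (R * Real.exp (-δ * R))) atTop (𝓝 0) := by
    simpa using (t0.const_mul (K * Real.exp M * ‖q - p‖)).add
      (t1.const_mul (K * Real.exp M * ‖w - v‖))
  refine this.congr fun R => ?_
  rw [show M - δ * R = M + -δ * R by ring, Real.exp_add]
  ring

open Filter Topology in
/-- Integrability on a half line. -/
lemma aux_int (D : Set ℂ) (h : ℂ → ℂ) (hc : ContinuousOn h D)
    (c d : ℂ) (K : ℝ) 
    (hb : ∀ t ∈ D, 1 ≤ (t * d).re → ‖h t‖ ≤ K * Real.exp ((t * c).re))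
    (p v : ℂ) (hvc : (v * c).re < 0) (hvd : 0 < (v * d).re)
    (hl : ∀ R : ℝ, p + R * v ∈ D) :
    IntegrableOn (fun R : ℝ => h (p + R * v)) (Set.Ioi 0) := by
  have hcont : Continuous (fun R : ℝ => h (p + R * v)) :=
    hc.comp_continuous (by fun_prop) hl
  rw [IntegrableOn, ← integrable_norm_iff hcont.aestronglyMeasurable]
  refine integrable_of_isBigO_exp_neg (b := -(v * c).re) (by linarith)
    hcont.norm.continuousOn ?_
  have e1 : ∀ᶠ R : ℝ in atTop, 1 ≤ (p * d).re + R * (v * d).re :=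
    (tendsto_atTop_add_const_left _ _ (tendsto_id.atTop_mul_const hvd)).eventually_ge_atTop 1
  refine Asymptotics.IsBigO.of_bound (K * Real.exp ((p * c).re)) ?_
  filter_upwards [e1] with R hR
  have lin : ∀ z : ℂ, ((p + R * v) * z).re = (p * z).re + R * (v * z).re := by
    intro z
    simp
    ring
  rw [norm_norm, Real.norm_of_nonneg (Real.exp_pos _).le, mul_assoc, ← Real.exp_add]
  refine (hb _ (hl R) (by rw [lin]; exact hR)).trans (le_of_eq ?_)
  rw [lin]
  ring_nf

open Filter Topology in
/-- The integral over a line as the limit of differences of a primitive. -/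
lemma aux_line (D : Set ℂ) (h H : ℂ → ℂ) (hc : ContinuousOn h D)
    (hH : ∀ z ∈ D, HasDerivAt H (h z) z)
    (c d c' d' : ℂ) (K : ℝ)
    (hb : ∀ t ∈ D, 1 ≤ (t * d).re → ‖h t‖ ≤ K * Real.exp ((t * c).re))
    (hb' : ∀ t ∈ D, 1 ≤ (t * d').re → ‖h t‖ ≤ K * Real.exp ((t * c').re))
    (p v : ℂ) (hvc : (v * c).re < 0) (hvd : 0 < (v * d).re)
    (hvc' : (-v * c').re < 0) (hvd' : 0 < (-v * d').re)
    (hl : ∀ R : ℝ, p + R * v ∈ D) :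
    Tendsto (fun R : ℝ => H (p + R * v) - H (p + R * (-v))) atTop
      (𝓝 (v * ∫ u : ℝ, h (p + u * v))) := by
  have hl' : ∀ R : ℝ, p + R * (-v) ∈ D := fun R => by
    have := hl (-R)
    push_cast at this
    rwa [neg_mul_comm] at this
  have hcont : Continuous (fun R : ℝ => h (p + R * v)) :=
    hc.comp_continuous (by fun_prop) hl
  have i1 := aux_int D h hc c d K hb p v hvc hvd hl
  have i2 := aux_int D h hc c' d' K hb' p (-v) hvc' hvd' hl'
  have i3 : IntegrableOn (fun R : ℝ => h (p + R * v)) (Set.Iic 0) := by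
    rw [integrableOn_Iic_iff_integrableOn_Iio]
    have := i2.comp_neg
    simpa using this
  have hint : Integrable (fun R : ℝ => h (p + R * v)) := by
    rw [← integrableOn_univ, ← Set.Iic_union_Ioi (a := (0:ℝ))]
    exact i3.union i1
  have := (intervalIntegral_tendsto_integral hint tendsto_neg_atTop_atBot
    (tendsto_id (α := ℝ))).const_mul v
  refine this.congr fun R => ?_
  rw [← intervalIntegral.integral_const_mul]
  have hder : ∀ x ∈ Set.uIcc (-R) (id R), HasDerivAt (fun R : ℝ => H (p + R * v))
      (v * h (p + x * v)) x := by
    intro x _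
    have h1 : HasDerivAt (fun R : ℝ => p + (R : ℂ) * v) v x := by
      simpa using ((Complex.ofRealCLM.hasDerivAt (x := x)).mul_const v).const_add p
    have := (hH _ (hl x)).scomp x h1
    simpa [Function.comp_def] using this
  rw [intervalIntegral.integral_eq_sub_of_hasDerivAt hder
    ((continuous_const.mul hcont).intervalIntegrable _ _)]
  simp

/-- Primitives on a union of open convex sets with a common point. -/
lemma aux_prim {ι : Type*} (S : ι → Set ℂ) (hS : ∀ i, Convex ℝ (S i)) (hSo : ∀ i, IsOpen (S i))
    (m : ℂ) (hm : ∀ i, m ∈ S i) (h : ℂ → ℂ) (hh : DifferentiableOn ℂ h (⋃ i, S i)) :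
    ∃ H : ℂ → ℂ, ∀ z ∈ ⋃ i, S i, HasDerivAt H (h z) z := by
  classical
  have hex : ∀ i, ∃ G : ℂ → ℂ, (∀ z ∈ S i, HasDerivAt G (h z) z) ∧ G m = 0 := by
    intro i
    obtain ⟨G, hG⟩ := (hS i).exists_forall_hasDerivWithinAt (hh.mono (Set.subset_iUnion S i))
    refine ⟨fun z => G z - G m, fun z hz => ?_, by simp⟩
    exact ((hG z hz).hasDerivAt ((hSo i).mem_nhds hz)).sub_const _
  choose G hG hGm using hex
  have hEq : ∀ i j z, z ∈ S i → z ∈ S j → G i z = G j z := by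
    intro i j z hi hj
    have hconv := (hS i).inter (hS j)
    have := hconv.norm_image_sub_le_of_norm_hasDerivWithin_le (f := fun z => G i z - G j z)
      (f' := fun z => h z - h z) (C := 0)
      (fun x hx => ((hG i x hx.1).sub (hG j x hx.2)).hasDerivWithinAt)
      (fun x hx => by simp) ⟨hm i, hm j⟩ ⟨hi, hj⟩
    simp only [hGm, zero_mul, sub_zero, norm_le_zero_iff] at this
    exact sub_eq_zero.mp this
  refine ⟨fun z => if hz : ∃ i, z ∈ S i then G hz.choose z else 0, fun z hz => ?_⟩
  obtain ⟨i, hi⟩ := Set.mem_iUnion.mp hz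
  refine (hG i z hi).congr_of_eventuallyEq ?_
  filter_upwards [(hSo i).mem_nhds hi] with y hy
  have hy' : ∃ i, y ∈ S i := ⟨i, hy⟩
  rw [dif_pos hy']
  exact hEq _ _ _ hy'.choose_spec hy

lemma aux_strip_convex (α : ℝ) (sqe : ℂ) (Λ : ℝ) : Convex ℝ (timeStrip α sqe Λ) := by
  have : IsLinearMap ℝ (fun t : ℂ => (Complex.exp (α * Complex.I) * t).re) :=
    ⟨fun x y => by rw [mul_add, Complex.add_re], fun r x => by
      rw [mul_smul_comm, Complex.smul_re]⟩
  exact (convex_Ioo Λ (stripWidth α sqe - Λ)).is_linear_preimage this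

lemma aux_strip_open (α : ℝ) (sqe : ℂ) (Λ : ℝ) : IsOpen (timeStrip α sqe Λ) := by
  have : Continuous (fun t : ℂ => (Complex.exp (α * Complex.I) * t).re) := by fun_prop
  exact isOpen_Ioo.preimage this

lemma aux_bound (sqe ξ : ℂ) (a b K : ℝ) (hab : 0 < a + b) (hK : 0 < K) (G t : ℂ)
    (hG : ‖G‖ ≤ K * ‖Complex.exp (-(2 * sqe) * t)‖ ^ a *
        ‖1 - Complex.exp (-(2 * sqe) * t)‖ ^ (-(a + b))) :
    (1 ≤ (t * (2 * sqe)).re → ‖G * Complex.exp (t * ξ)‖ ≤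
      (K * (1 - Real.exp (-1)) ^ (-(a + b))) * Real.exp ((t * (ξ - (2 * a : ℝ) * sqe)).re)) ∧
    (1 ≤ (t * (-(2 * sqe))).re → ‖G * Complex.exp (t * ξ)‖ ≤
      (K * (1 - Real.exp (-1)) ^ (-(a + b))) * Real.exp ((t * (ξ + (2 * b : ℝ) * sqe)).re)) := by
  set x := (t * sqe).re with hx
  have e0 : 0 < 1 - Real.exp (-1) := by
    have : Real.exp (-1) < 1 := by rw [Real.exp_lt_one_iff]; norm_num
    linarith
  have hn : ‖Complex.exp (-(2 * sqe) * t)‖ = Real.exp (-(2 * x)) := by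
    rw [Complex.norm_exp]
    congr 1
    rw [show -(2 * sqe) * t = ((-2 : ℝ) : ℂ) * (t * sqe) by push_cast; ring, Complex.re_ofReal_mul]
    ring
  rw [hn, ← Real.exp_mul] at hG
  have r1 : (t * (2 * sqe)).re = 2 * x := by
    rw [show t * (2 * sqe) = ((2 : ℝ) : ℂ) * (t * sqe) by push_cast; ring, Complex.re_ofReal_mul]
  have r2 : (t * (-(2 * sqe))).re = -(2 * x) := by
    rw [mul_neg, Complex.neg_re, r1]
  have r3 : ∀ s : ℝ, (t * ((s : ℂ) * sqe)).re = s * x := by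
    intro s
    rw [show t * ((s : ℂ) * sqe) = (s : ℂ) * (t * sqe) by ring, Complex.re_ofReal_mul]
  rw [r1, r2, mul_sub, mul_add, Complex.sub_re, Complex.add_re, r3, r3, norm_mul,
    Complex.norm_exp]
  constructor
  · intro h1
    have l1 : 1 - Real.exp (-1) ≤ ‖1 - Complex.exp (-(2 * sqe) * t)‖ := by
      have := norm_sub_norm_le (1 : ℂ) (Complex.exp (-(2 * sqe) * t))
      rw [hn, norm_one] at this
      have : Real.exp (-(2 * x)) ≤ Real.exp (-1) := Real.exp_le_exp.mpr (by linarith)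
      linarith
    have l2 := Real.rpow_le_rpow_of_nonpos e0 l1 (show -(a + b) ≤ 0 by linarith)
    calc ‖G‖ * Real.exp (t * ξ).re
        ≤ (K * Real.exp (-(2 * x) * a) * (1 - Real.exp (-1)) ^ (-(a + b))) *
            Real.exp (t * ξ).re := by
          gcongr
          exact hG.trans (by gcongr)
      _ = _ := by
          rw [show (t * ξ).re - 2 * a * x = -(2 * x) * a + (t * ξ).re by ring, Real.exp_add]
          ring
  · intro h1
    have l1 : Real.exp (-(2 * x)) * (1 - Real.exp (-1)) ≤
        ‖1 - Complex.exp (-(2 * sqe) * t)‖ := by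
      have := norm_sub_norm_le (Complex.exp (-(2 * sqe) * t)) 1
      rw [hn, norm_one, norm_sub_rev] at this
      have h2 : Real.exp (-(2 * x)) * Real.exp (-1) ≥ 1 := by
        rw [← Real.exp_add]
        exact Real.one_le_exp (by linarith)
      linarith
    have l2 := Real.rpow_le_rpow_of_nonpos (mul_pos (Real.exp_pos _) e0) l1
      (show -(a + b) ≤ 0 by linarith)
    rw [Real.mul_rpow (Real.exp_pos _).le e0.le, ← Real.exp_mul] at l2
    calc ‖G‖ * Real.exp (t * ξ).re
        ≤ (K * Real.exp (-(2 * x) * a) * (Real.exp (-(2 * x) * (-(a + b))) *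
            (1 - Real.exp (-1)) ^ (-(a + b)))) * Real.exp (t * ξ).re := by
          gcongr
          exact hG.trans (by gcongr)
      _ = K * (1 - Real.exp (-1)) ^ (-(a + b)) * (Real.exp (-(2 * x) * a) *
            Real.exp (-(2 * x) * (-(a + b))) * Real.exp (t * ξ).re) := by ring
      _ = _ := by
          rw [← Real.exp_add, ← Real.exp_add]
          ring_nf

/-- The direction of the lines. -/
noncomputable def auxDir (α : ℝ) : ℂ := Complex.I * Complex.exp (-α * Complex.I)

lemma auxDir_re (α : ℝ) (z : ℂ) :
    (auxDir α * z).re = -(Complex.exp (-α * Complex.I) * z).im := by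
  rw [auxDir, mul_assoc, Complex.I_mul_re]

lemma auxDir_exp (α β : ℝ) :
    (Complex.exp (β * Complex.I) * auxDir α).re = Real.sin (α - β) := by
  rw [auxDir, mul_left_comm, ← Complex.exp_add, Complex.I_mul_re,
    show (β : ℂ) * Complex.I + -α * Complex.I = ((β - α : ℝ) : ℂ) * Complex.I by push_cast; ring,
    Complex.exp_ofReal_mul_I_im, ← Real.sin_neg]
  ring_nf

lemma auxDir_sqe (α : ℝ) (sqe : ℂ) (hsqe : sqe ≠ 0) (h₁ : Complex.arg sqe < α)
    (h₂ : α < Complex.arg sqe + Real.pi) : 0 < (auxDir α * (2 * sqe)).re := by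
  have : sqe = (‖sqe‖ : ℂ) * Complex.exp (Complex.arg sqe * Complex.I) :=
    (Complex.norm_mul_exp_arg_mul_I sqe).symm
  have e : auxDir α * (2 * sqe) = ((2 * ‖sqe‖ : ℝ) : ℂ) *
      (Complex.exp (Complex.arg sqe * Complex.I) * auxDir α) := by
    conv_lhs => rw [this]
    push_cast
    ring
  rw [e, Complex.re_ofReal_mul, auxDir_exp]
  have := norm_pos_iff.mpr hsqe
  have := Real.sin_pos_of_pos_of_lt_pi (x := α - Complex.arg sqe) (by linarith) (by linarith)
  positivity

lemma aux_timePt (α C u : ℝ) :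
    timePt α C u = Complex.exp (-α * Complex.I) * C + u * auxDir α := by
  rw [timePt, auxDir]; ring

lemma aux_timePt_mem (α C u : ℝ) :
    (Complex.exp (α * Complex.I) * timePt α C u).re = C := by
  rw [timePt, ← mul_assoc, ← Complex.exp_add]
  simp

lemma aux_mid (α : ℝ) (sqe : ℂ) :
    (Complex.exp (α * Complex.I) * (-(Real.pi * Complex.I) / (2 * sqe))).re =
      stripWidth α sqe / 2 := by
  rw [stripWidth, show Complex.exp (α * Complex.I) * (-(Real.pi * Complex.I) / (2 * sqe)) =
    ((-1 / 2 : ℝ) : ℂ) * (Complex.exp (α * Complex.I) * (Real.pi * Complex.I) / sqe) by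
      push_cast; rw [div_mul_eq_div_div]; ring, Complex.re_ofReal_mul]
  ring

lemma aux_zero (α₁ α₂ : ℝ) (h₁₂ : α₁ < α₂) (hpi : α₂ < α₁ + Real.pi) (s r : ℝ)
    (hs : 0 ≤ s) (hr : 0 ≤ r) : ∃ α ∈ Set.Icc α₁ α₂,
      (Complex.exp (α * Complex.I) * (s * auxDir α₁ + r * auxDir α₂)).re = 0 := by
  have hc : Continuous (fun α : ℝ =>
    (Complex.exp (α * Complex.I) * (s * auxDir α₁ + r * auxDir α₂)).re) := by fun_prop
  have hsin := Real.sin_pos_of_pos_of_lt_pi (x := α₂ - α₁) (by linarith) (by linarith)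
  have ev : ∀ α : ℝ, (Complex.exp (α * Complex.I) * (s * auxDir α₁ + r * auxDir α₂)).re =
      s * Real.sin (α₁ - α) + r * Real.sin (α₂ - α) := by
    intro α
    rw [mul_add, mul_left_comm, mul_left_comm _ (r : ℂ), Complex.add_re, Complex.re_ofReal_mul,
      Complex.re_ofReal_mul, auxDir_exp, auxDir_exp]
  have := intermediate_value_Icc' h₁₂.le hc.continuousOn
  obtain ⟨α, hα, h0⟩ := this (show (0 : ℝ) ∈ _ from by
    constructor
    · rw [ev, sub_self, Real.sin_zero, ← neg_sub α₂ α₁, Real.sin_neg]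
      have := mul_nonneg hs hsin.le
      linarith
    · rw [ev, sub_self, Real.sin_zero]
      have := mul_nonneg hr hsin.le
      linarith)
  exact ⟨α, hα, h0⟩

/-- Proposition 3.3, part 1, of the paper: analytic continuation in
the direction `α`. The unfolded Borel transforms of `g` in two admissible directions
`α₁ < α₂` agree on the intersection `Ω_{α₁}(a,b) ∩ Ω_{α₂}(a,b)` of the corresponding
strips of the Borel plane. -/
theorem unfolded_borel_direction_independence
    (ε sqe : ℂ) (hsq : sqe ^ 2 = ε) (hsqe : sqe ≠ 0)
    (α₁ α₂ : ℝ) (h₁ : Complex.arg sqe < α₁) (h₁₂ : α₁ < α₂)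
    (h₂ : α₂ < Complex.arg sqe + Real.pi)
    (Λ : ℝ) (hΛ : 0 ≤ Λ)
    (hΛw : ∀ α ∈ Set.Icc α₁ α₂, 2 * Λ < stripWidth α sqe)
    (a b : ℝ) (hab : 0 < a + b)
    (g : ℂ → ℂ)
    (hg : DifferentiableOn ℂ g (⋃ α ∈ Set.Icc α₁ α₂, timeStrip α sqe Λ))
    (K : ℝ) (hK : 0 < K)
    (hbound : ∀ t ∈ ⋃ α ∈ Set.Icc α₁ α₂, timeStrip α sqe Λ,
      ‖g t‖ ≤ K * ‖Complex.exp (-(2 * sqe) * t)‖ ^ a *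
        ‖1 - Complex.exp (-(2 * sqe) * t)‖ ^ (-(a + b))) :
    ∀ ξ ∈ borelStrip α₁ sqe a b ∩ borelStrip α₂ sqe a b,
      ∀ C₁ C₂ : ℝ, Λ < C₁ → C₁ < stripWidth α₁ sqe - Λ →
        Λ < C₂ → C₂ < stripWidth α₂ sqe - Λ →
        unfoldedBorel α₁ g C₁ ξ = unfoldedBorel α₂ g C₂ ξ := by
  intro ξ hξ C₁ C₂ hC₁ hC₁' hC₂ hC₂'
  classical
  set D : Set ℂ := ⋃ α ∈ Set.Icc α₁ α₂, timeStrip α sqe Λ with hD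
  have hDi : D = ⋃ i : Set.Icc α₁ α₂, timeStrip i sqe Λ := by
    rw [hD, Set.biUnion_eq_iUnion]
  have hmem : ∀ α ∈ Set.Icc α₁ α₂, ∀ t ∈ timeStrip α sqe Λ, t ∈ D := fun α hα t ht =>
    Set.mem_biUnion hα ht
  set m : ℂ := -(Real.pi * Complex.I) / (2 * sqe) with hm
  have hmid : ∀ α ∈ Set.Icc α₁ α₂, ∀ z : ℂ, (Complex.exp (α * Complex.I) * z).re = 0 →
      m + z ∈ timeStrip α sqe Λ := by
    intro α hα z hz
    have hw := hΛw α hα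
    have e : (Complex.exp (α * Complex.I) * (m + z)).re = stripWidth α sqe / 2 := by
      rw [mul_add, Complex.add_re, hz, hm, aux_mid, add_zero]
    constructor <;> rw [e] <;> linarith
  set h : ℂ → ℂ := fun t => g t * Complex.exp (t * ξ) with hh
  have hhd : DifferentiableOn ℂ h D := by
    refine hg.mul (Differentiable.differentiableOn ?_)
    fun_prop
  obtain ⟨H, hH⟩ : ∃ H : ℂ → ℂ, ∀ z ∈ D, HasDerivAt H (h z) z := by
    rw [hDi] at hhd ⊢
    refine aux_prim (fun i : Set.Icc α₁ α₂ => timeStrip i sqe Λ)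
      (fun i => aux_strip_convex _ _ _) (fun i => aux_strip_open _ _ _) m (fun i => ?_) h hhd
    simpa using hmid i i.2 0 (by simp)
  set K' := K * (1 - Real.exp (-1)) ^ (-(a + b)) with hK'
  have hK'0 : 0 ≤ K' := by
    have : Real.exp (-1) < 1 := by rw [Real.exp_lt_one_iff]; norm_num
    have : 0 ≤ 1 - Real.exp (-1) := by linarith
    positivity
  set c : ℂ := ξ - (2 * a : ℝ) * sqe with hc
  set c' : ℂ := ξ + (2 * b : ℝ) * sqe with hc'
  have hb : ∀ t ∈ D, 1 ≤ (t * (2 * sqe)).re → ‖h t‖ ≤ K' * Real.exp ((t * c).re) :=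
    fun t ht => (aux_bound sqe ξ a b K hab hK (g t) t (hbound t ht)).1
  have hb' : ∀ t ∈ D, 1 ≤ (t * (-(2 * sqe))).re → ‖h t‖ ≤ K' * Real.exp ((t * c').re) :=
    fun t ht => (aux_bound sqe ξ a b K hab hK (g t) t (hbound t ht)).2
  have hdir : ∀ α : ℝ, ξ ∈ borelStrip α sqe a b →
      (auxDir α * c).re < 0 ∧ (-auxDir α * c').re < 0 := by
    intro α hα
    obtain ⟨q1, q2⟩ := hα
    rw [neg_mul, Complex.neg_re, auxDir_re, auxDir_re, hc, hc', mul_sub, mul_add,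
      Complex.sub_im, Complex.add_im]
    constructor <;> linarith
  obtain ⟨d1, d1'⟩ := hdir α₁ hξ.1
  obtain ⟨d2, d2'⟩ := hdir α₂ hξ.2
  have s1 := auxDir_sqe α₁ sqe hsqe h₁ (by linarith)
  have s2 := auxDir_sqe α₂ sqe hsqe (by linarith) h₂
  have s1' : 0 < (-auxDir α₁ * (-(2 * sqe))).re := by rwa [neg_mul_neg]
  have s2' : 0 < (-auxDir α₂ * (-(2 * sqe))).re := by rwa [neg_mul_neg]
  have hI₁ : α₁ ∈ Set.Icc α₁ α₂ := ⟨le_rfl, h₁₂.le⟩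
  have hI₂ : α₂ ∈ Set.Icc α₁ α₂ := ⟨h₁₂.le, le_rfl⟩
  set p₁ : ℂ := Complex.exp (-α₁ * Complex.I) * C₁ with hp₁
  set p₂ : ℂ := Complex.exp (-α₂ * Complex.I) * C₂ with hp₂
  have l1 : ∀ R : ℝ, p₁ + R * auxDir α₁ ∈ timeStrip α₁ sqe Λ := by
    intro R
    rw [hp₁, ← aux_timePt]
    constructor <;> rw [aux_timePt_mem] <;> assumption
  have l2 : ∀ R : ℝ, p₂ + R * auxDir α₂ ∈ timeStrip α₂ sqe Λ := by
    intro R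
    rw [hp₂, ← aux_timePt]
    constructor <;> rw [aux_timePt_mem] <;> assumption
  have hm0 : ∀ (α R : ℝ), (Complex.exp (α * Complex.I) * (R * auxDir α)).re = 0 := by
    intro α R
    rw [mul_left_comm, Complex.re_ofReal_mul, auxDir_exp]
    simp
  have m1 : ∀ R : ℝ, m + R * auxDir α₁ ∈ timeStrip α₁ sqe Λ := fun R =>
    hmid _ hI₁ _ (hm0 _ _)
  have m2 : ∀ R : ℝ, m + R * auxDir α₂ ∈ timeStrip α₂ sqe Λ := fun R =>
    hmid _ hI₂ _ (hm0 _ _)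
  have hneg : ∀ (q v : ℂ) (S : Set ℂ), (∀ R : ℝ, q + R * v ∈ S) →
      ∀ R : ℝ, q + R * (-v) ∈ S := by
    intro q v S hS R
    have := hS (-R)
    push_cast at this
    rwa [neg_mul_comm] at this
  have hsub : ∀ α ∈ Set.Icc α₁ α₂, ∀ x y : ℂ, x ∈ timeStrip α sqe Λ → y ∈ timeStrip α sqe Λ →
      segment ℝ x y ⊆ D := fun α hα x y hx hy =>
    ((aux_strip_convex α sqe Λ).segment_subset hx hy).trans (fun t ht => hmem α hα t ht)
  have hmm : ∀ R : ℝ, segment ℝ (m + R * auxDir α₁) (m + R * auxDir α₂) ⊆ D := by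
    rintro R _ ⟨s, r, hs, hr, hsr, rfl⟩
    obtain ⟨α, hα, h0⟩ := aux_zero α₁ α₂ h₁₂ (by linarith) s r hs hr
    have e : s • (m + R * auxDir α₁) + r • (m + R * auxDir α₂) =
        m + R * (s * auxDir α₁ + r * auxDir α₂) := by
      have : (s : ℂ) + r = 1 := by exact_mod_cast hsr
      simp only [Complex.real_smul]
      linear_combination m * this
    rw [e]
    refine hmem α hα _ (hmid α hα _ ?_)
    rw [mul_left_comm, Complex.re_ofReal_mul, h0, mul_zero]
  have hmm' : ∀ R : ℝ, segment ℝ (m + R * (-auxDir α₁)) (m + R * (-auxDir α₂)) ⊆ D := by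
    intro R
    have := hmm (-R)
    push_cast at this
    rwa [neg_mul_comm, neg_mul_comm] at this
  have T1 := aux_line D h H hhd.continuousOn hH c (2 * sqe) c' (-(2 * sqe)) K' hb hb' p₁ (auxDir α₁)
    d1 s1 d1' s1' (fun R => hmem _ hI₁ _ (l1 R))
  have T2 := aux_line D h H hhd.continuousOn hH c (2 * sqe) c' (-(2 * sqe)) K' hb hb' p₂ (auxDir α₂)
    d2 s2 d2' s2' (fun R => hmem _ hI₂ _ (l2 R))
  have E1 := aux_end D h H hH c (2 * sqe) K' hK'0 hb p₁ (auxDir α₁) m (auxDir α₁) d1 d1 s1 s1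
    (fun R _ => hsub _ hI₁ _ _ (l1 R) (m1 R))
  have E2 := aux_end D h H hH c (2 * sqe) K' hK'0 hb m (auxDir α₁) m (auxDir α₂) d1 d2 s1 s2
    (fun R _ => hmm R)
  have E3 := aux_end D h H hH c (2 * sqe) K' hK'0 hb m (auxDir α₂) p₂ (auxDir α₂) d2 d2 s2 s2
    (fun R _ => hsub _ hI₂ _ _ (m2 R) (l2 R))
  have F1 := aux_end D h H hH c' (-(2 * sqe)) K' hK'0 hb' p₁ (-auxDir α₁) m (-auxDir α₁)
    d1' d1' s1' s1' (fun R _ => hsub _ hI₁ _ _ (hneg _ _ _ l1 R) (hneg _ _ _ m1 R))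
  have F2 := aux_end D h H hH c' (-(2 * sqe)) K' hK'0 hb' m (-auxDir α₁) m (-auxDir α₂)
    d1' d2' s1' s2' (fun R _ => hmm' R)
  have F3 := aux_end D h H hH c' (-(2 * sqe)) K' hK'0 hb' m (-auxDir α₂) p₂ (-auxDir α₂)
    d2' d2' s2' s2' (fun R _ => hsub _ hI₂ _ _ (hneg _ _ _ m2 R) (hneg _ _ _ l2 R))
  have key : auxDir α₁ * (∫ u : ℝ, h (p₁ + u * auxDir α₁)) =
      auxDir α₂ * ∫ u : ℝ, h (p₂ + u * auxDir α₂) := by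
    have L := ((T1.add E1).add E2).add E3
    have L' := (((L.sub F1).sub F2).sub F3)
    simp only [add_zero, sub_zero] at L'
    refine tendsto_nhds_unique (L'.congr fun R => ?_) T2
    ring
  have fin : ∀ α C : ℝ, unfoldedBorel α g C ξ = (1 / (2 * Real.pi * Complex.I)) *
      (auxDir α * ∫ u : ℝ, h (Complex.exp (-α * Complex.I) * C + u * auxDir α)) := by
    intro α C
    rw [unfoldedBorel, mul_assoc]
    simp only [hh, aux_timePt]
    rfl
  rw [fin, fin, key]
end
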